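/- Assume (A3) and (A6), and let (f₋, f₊) be the unique solution of Luckock's equation. Let g₋ : Ī → ℝ be bounded, left-continuous and of bounded variation, and g₊ : Ī → ℝ bounded, right-continuous and of bounded variation, and let c ∈ ℝ be the unique constant for which there exist weight functions (w₋, w₊) (bounded, w₋ left-continuous of bounded variation, w₊ right-continuous of bounded variation, w₋(I₋) = 0 = w₊(I₊)) whose associated linear functional F satisfies GF(X) = g₋(M₋(X)) + g₊(M₊(X)) − c for all configurations X. Then c = g₋(I₊)f₋(I₊) − ∫_{Ī} f₋ dg₋ + g₊(I₋)f₊(I₋) + ∫_{Ī} f₊ dg₊. -/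

import Mathlib

open MeasureTheory Set
open scoped ENNReal

noncomputable section

/-- The right limit of `f` at `x`, with the convention `f(b+) := f b` at the
right endpoint `b`. -/
def rLim (b : ℝ) (f : ℝ → ℝ) (x : ℝ) : ℝ :=
  if x < b then Function.rightLim f x else f b

/-- `ν` is the Lebesgue-Stieltjes signed measure `df` of `f` on the interval `[a,b]`,
with the conventions `f(a−) := f a` and `f(b+) := f b`. -/
def IsLS (a b : ℝ) (f : ℝ → ℝ) (ν : MeasureTheory.SignedMeasure ℝ) : Prop :=
  (∀ s : Set ℝ, MeasurableSet s → s ∩ Set.Icc a b = ∅ → ν s = 0) ∧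
  (∀ x y : ℝ, a ≤ x → x ≤ y → y ≤ b → ν (Set.Ioc x y) = rLim b f y - rLim b f x) ∧
  ν {a} = rLim b f a - f a

/-- The integral `∫_s g dν` of `g` over `s` against the signed measure `ν`. -/
def sInt (ν : MeasureTheory.SignedMeasure ℝ) (g : ℝ → ℝ) (s : Set ℝ) : ℝ :=
  (∫ x in s, g x ∂ν.toJordanDecomposition.posPart) -
    ∫ x in s, g x ∂ν.toJordanDecomposition.negPart

/-- Assumption (A3): `lm` (demand) is continuous and nonincreasing, `lp` (supply) is
continuous and nondecreasing on `[a,b]`; both are nonnegative. -/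
def A3 (a b : ℝ) (lm lp : ℝ → ℝ) : Prop :=
  ContinuousOn lm (Set.Icc a b) ∧ ContinuousOn lp (Set.Icc a b) ∧
  AntitoneOn lm (Set.Icc a b) ∧ MonotoneOn lp (Set.Icc a b) ∧
  (∀ x ∈ Set.Icc a b, 0 ≤ lm x) ∧ (∀ x ∈ Set.Icc a b, 0 ≤ lp x)

/-- Assumption (A6): the rates of market orders are positive. -/
def A6 (a b : ℝ) (lm lp : ℝ → ℝ) : Prop := 0 < lp a ∧ 0 < lm b

/-- `(fm, fp)` is a solution of Luckock's equation on `[a,b]` for demand/supply `lm, lp`: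
both are continuous of bounded variation, `fm dlp + lm dfp = 0` and `fp dlm + lp dfm = 0`
as signed measures on `[a,b]`, and `fm b = 1 = fp a`. -/
def LuckockSol (a b : ℝ) (lm lp fm fp : ℝ → ℝ) : Prop :=
  ContinuousOn fm (Set.Icc a b) ∧ ContinuousOn fp (Set.Icc a b) ∧
  BoundedVariationOn fm (Set.Icc a b) ∧ BoundedVariationOn fp (Set.Icc a b) ∧
  fm b = 1 ∧ fp a = 1 ∧
  ∀ νlm νlp νfm νfp : MeasureTheory.SignedMeasure ℝ,
    IsLS a b lm νlm → IsLS a b lp νlp → IsLS a b fm νfm → IsLS a b fp νfp →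
    ∀ s : Set ℝ, MeasurableSet s →
      sInt νlp fm s + sInt νfp lm s = 0 ∧ sInt νlm fp s + sInt νfm lp s = 0

/-- The state of the order book: the multiset of buy limit order prices and the
multiset of sell limit order prices. -/
structure OrderBook where
  minus : Multiset ℝ
  plus : Multiset ℝ

/-- A valid configuration on the interval `(a,b)`: all orders have prices in `(a,b)`
and every buy order is strictly below every sell order. -/
def IsConfig (a b : ℝ) (X : OrderBook) : Prop :=
  (∀ x ∈ X.minus, x ∈ Set.Ioo a b) ∧ (∀ x ∈ X.plus, x ∈ Set.Ioo a b) ∧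
  ∀ x ∈ X.minus, ∀ y ∈ X.plus, x < y

/-- The best (highest) buy offer, `a` if there are no buy limit orders. -/
def Mminus (a : ℝ) (X : OrderBook) : ℝ := sSup (insert a {x | x ∈ X.minus})

/-- The best (lowest) sell offer, `b` if there are no sell limit orders. -/
def Mplus (b : ℝ) (X : OrderBook) : ℝ := sInf (insert b {x | x ∈ X.plus})

open scoped Classical in
/-- The Luckock map for a buy order at price level `u` (`u = b` is a buy market order). -/
def Lminus (a b u : ℝ) (X : OrderBook) : OrderBook :=
  if X.plus ≠ 0 ∧ Mplus b X ≤ u then ⟨X.minus, X.plus.erase (Mplus b X)⟩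
  else if u ∈ Set.Ioo a b then ⟨u ::ₘ X.minus, X.plus⟩ else X

open scoped Classical in
/-- The Luckock map for a sell order at price level `u` (`u = a` is a sell market order). -/
def Lplus (a b u : ℝ) (X : OrderBook) : OrderBook :=
  if X.minus ≠ 0 ∧ u ≤ Mminus a X then ⟨X.minus.erase (Mminus a X), X.plus⟩
  else if u ∈ Set.Ioo a b then ⟨X.minus, u ::ₘ X.plus⟩ else X

/-- The linear functional associated with the weight functions `wm, wp`. -/
def linF (wm wp : ℝ → ℝ) (X : OrderBook) : ℝ :=
  (X.minus.map wm).sum + (X.plus.map wp).sum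

/-- The generator of the Stigler-Luckock model with arrival measures `μm, μp`. -/
def genOp (a b : ℝ) (μm μp : MeasureTheory.Measure ℝ) (F : OrderBook → ℝ)
    (X : OrderBook) : ℝ :=
  (∫ u, (F (Lminus a b u X) - F X) ∂μm) + ∫ u, (F (Lplus a b u X) - F X) ∂μp

/-- `μm` is the arrival measure of buy orders: `μm [x, b] = lm x`, supported on `[a,b]`. -/
def IsMuMinus (a b : ℝ) (lm : ℝ → ℝ) (μm : MeasureTheory.Measure ℝ) : Prop :=
  (∀ x ∈ Set.Icc a b, μm (Set.Icc x b) = ENNReal.ofReal (lm x)) ∧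
  μm (Set.Icc a b)ᶜ = 0

/-- `μp` is the arrival measure of sell orders: `μp [a, x] = lp x`, supported on `[a,b]`. -/
def IsMuPlus (a b : ℝ) (lp : ℝ → ℝ) (μp : MeasureTheory.Measure ℝ) : Prop :=
  (∀ x ∈ Set.Icc a b, μp (Set.Icc a x) = ENNReal.ofReal (lp x)) ∧
  μp (Set.Icc a b)ᶜ = 0

/-- An admissible pair of weight functions: bounded, of bounded variation, `wm`
left-continuous, `wp` right-continuous, with `wm a = 0` and `wp b = 0`. -/
def WPair (a b : ℝ) (wm wp : ℝ → ℝ) : Prop :=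
  (∃ C, ∀ x ∈ Set.Icc a b, |wm x| ≤ C) ∧ (∃ C, ∀ x ∈ Set.Icc a b, |wp x| ≤ C) ∧
  BoundedVariationOn wm (Set.Icc a b) ∧ BoundedVariationOn wp (Set.Icc a b) ∧
  (∀ x ∈ Set.Ioc a b, ContinuousWithinAt wm (Set.Iio x) x) ∧
  (∀ x ∈ Set.Ico a b, ContinuousWithinAt wp (Set.Ioi x) x) ∧
  wm a = 0 ∧ wp b = 0

/-- A bounded measurable real function. -/
def BddMeas (f : ℝ → ℝ) : Prop := Measurable f ∧ ∃ C, ∀ x, |f x| ≤ C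

namespace BddMeas

variable {f g : ℝ → ℝ}

lemma const (c : ℝ) : BddMeas fun _ => c := ⟨measurable_const, |c|, fun _ => le_rfl⟩

lemma add (hf : BddMeas f) (hg : BddMeas g) : BddMeas fun x => f x + g x := by
  obtain ⟨hf, C, hC⟩ := hf
  obtain ⟨hg, D, hD⟩ := hg
  exact ⟨hf.add hg, C + D, fun x => (abs_add_le _ _).trans (add_le_add (hC x) (hD x))⟩

lemma mul (hf : BddMeas f) (hg : BddMeas g) : BddMeas fun x => f x * g x := by
  obtain ⟨hf, C, hC⟩ := hf
  obtain ⟨hg, D, hD⟩ := hg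
  refine ⟨hf.mul hg, C * D, fun x => ?_⟩
  rw [abs_mul]
  exact mul_le_mul (hC x) (hD x) (abs_nonneg _) ((abs_nonneg _).trans (hC x))

lemma sub (hf : BddMeas f) (hg : BddMeas g) : BddMeas fun x => f x - g x := by
  simpa [sub_eq_add_neg] using hf.add ((const (-1)).mul hg)

lemma integrable (hf : BddMeas f) (μ : Measure ℝ) [IsFiniteMeasure μ] : Integrable f μ := by
  obtain ⟨hf, C, hC⟩ := hf
  exact Integrable.of_bound hf.aestronglyMeasurable C (Filter.Eventually.of_forall hC)

end BddMeas

/-- The constant extension to `ℝ` of the restriction of `f` to `[a,b]`. -/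
def extend {a b : ℝ} (hab : a ≤ b) (f : ℝ → ℝ) : ℝ → ℝ := IccExtend hab ((Icc a b).domRestrict f)

section extend

variable {a b : ℝ} (hab : a ≤ b) {f : ℝ → ℝ}

lemma extend_apply (x : ℝ) : extend hab f x = f (projIcc a b hab x) := rfl

lemma extend_of_mem {x : ℝ} (hx : x ∈ Icc a b) : extend hab f x = f x := by
  rw [extend_apply, projIcc_of_mem hab hx]

lemma bddMeas_extend_of_continuousOn (hf : ContinuousOn f (Icc a b)) :
    BddMeas (extend hab f) := by
  obtain ⟨C, hC⟩ := isCompact_Icc.exists_bound_of_continuousOn hf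
  exact ⟨(hf.domRestrict.Icc_extend').measurable, C, fun x => hC _ (projIcc a b hab x).2⟩

lemma boundedVariationOn_extend (hf : BoundedVariationOn f (Icc a b)) :
    BoundedVariationOn (extend hab f) univ := by
  have h : eVariationOn (f ∘ fun x => (projIcc a b hab x : ℝ)) univ ≤ eVariationOn f (Icc a b) :=
    eVariationOn.comp_le_of_monotoneOn f (t := univ) (fun x => (projIcc a b hab x : ℝ))
      (fun x _ y _ hxy => monotone_projIcc hab hxy) (fun x _ => (projIcc a b hab x).2)
  exact (h.trans_lt (lt_top_iff_ne_top.2 hf)).ne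

lemma bddMeas_extend (hf : BoundedVariationOn f (Icc a b)) : BddMeas (extend hab f) := by
  have hbv := boundedVariationOn_extend hab hf
  obtain ⟨p, q, hp, hq, hpq⟩ := hbv.locallyBoundedVariationOn.exists_monotoneOn_sub_monotoneOn
  refine ⟨?_, ?_⟩
  · rw [hpq]
    exact (monotoneOn_univ.1 hp).measurable.sub (monotoneOn_univ.1 hq).measurable
  · refine ⟨|f a| + (eVariationOn (extend hab f) univ).toReal, fun x => ?_⟩
    have h := hbv.dist_le (mem_univ x) (mem_univ a)
    rw [Real.dist_eq, extend_of_mem hab (left_mem_Icc.2 hab)] at h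
    have := abs_add_le (extend hab f x - f a) (f a)
    rw [sub_add_cancel] at this
    linarith

end extend

section signed

variable {σ τ : SignedMeasure ℝ} {f g w : ℝ → ℝ}

lemma sInt_univ (σ : SignedMeasure ℝ) (f : ℝ → ℝ) :
    sInt σ f univ = (∫ x, f x ∂σ.toJordanDecomposition.posPart) -
      ∫ x, f x ∂σ.toJordanDecomposition.negPart := by
  simp [sInt]

lemma sInt_sub (σ : SignedMeasure ℝ) (hf : BddMeas f) (hg : BddMeas g) :
    sInt σ (fun x => f x - g x) univ = sInt σ f univ - sInt σ g univ := by
  simp only [sInt_univ]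
  rw [integral_sub (hf.integrable _) (hg.integrable _),
    integral_sub (hf.integrable _) (hg.integrable _)]
  ring

lemma sInt_const (σ : SignedMeasure ℝ) (c : ℝ) : sInt σ (fun _ => c) univ = c * σ univ := by
  rw [sInt_univ, σ.apply_eq_posPart_real_sub_negPart_real MeasurableSet.univ]
  simp only [integral_const, smul_eq_mul]
  ring

/-- A signed measure vanishing on all measurable subsets of a set has null Jordan parts there. -/
lemma jordan_null {t : Set ℝ} (ht : MeasurableSet t)
    (h : ∀ s, MeasurableSet s → s ⊆ t → σ s = 0) :
    σ.toJordanDecomposition.posPart t = 0 ∧ σ.toJordanDecomposition.negPart t = 0 := by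
  obtain ⟨i, hi, h0, h1, hp, hn⟩ := σ.toJordanDecomposition_spec
  rw [hp, hn, SignedMeasure.toMeasureOfZeroLE_apply _ _ hi ht,
    SignedMeasure.toMeasureOfLEZero_apply _ _ hi.compl ht]
  have e1 := h (i ∩ t) (hi.inter ht) inter_subset_right
  have e2 := h (iᶜ ∩ t) (hi.compl.inter ht) inter_subset_right
  constructor
  · rw [ENNReal.coe_eq_zero, ← NNReal.coe_eq_zero]; simpa using e1
  · rw [ENNReal.coe_eq_zero, ← NNReal.coe_eq_zero]; simpa using e2

lemma sInt_congr_of_null {t : Set ℝ} (ht : MeasurableSet t)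
    (h : ∀ s, MeasurableSet s → s ⊆ tᶜ → σ s = 0) (hfg : EqOn f g t) (s : Set ℝ) :
    sInt σ f s = sInt σ g s := by
  obtain ⟨h1, h2⟩ := jordan_null ht.compl h
  have key : ∀ μ : Measure ℝ, μ tᶜ = 0 → ∫ x in s, f x ∂μ = ∫ x in s, g x ∂μ := fun μ hμ =>
    integral_congr_ae (ae_restrict_of_ae (by
      filter_upwards [mem_ae_iff.2 hμ] with x hx using hfg hx))
  rw [sInt, sInt, key _ h1, key _ h2]

lemma sInt_toSignedMeasure (μ : Measure ℝ) [IsFiniteMeasure μ] (f : ℝ → ℝ) (s : Set ℝ) :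
    sInt μ.toSignedMeasure f s = ∫ x in s, f x ∂μ := by
  have : μ.toSignedMeasure.toJordanDecomposition =
      ⟨μ, 0, Measure.MutuallySingular.zero_right⟩ :=
    SignedMeasure.toJordanDecomposition_eq (by simp [JordanDecomposition.toSignedMeasure])
  simp [sInt, this]

lemma sInt_neg (σ : SignedMeasure ℝ) (f : ℝ → ℝ) (s : Set ℝ) : sInt (-σ) f s = -sInt σ f s := by
  simp [sInt, SignedMeasure.toJordanDecomposition_neg]

/-- If `f dσ + g dτ = 0` as signed measures, then `w f dσ + w g dτ = 0`. -/
lemma sInt_mul_add_eq_zero (hf : BddMeas f) (hg : BddMeas g) (hw : BddMeas w)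
    (h : ∀ s, MeasurableSet s → sInt σ f s + sInt τ g s = 0) :
    sInt σ (fun x => w x * f x) univ + sInt τ (fun x => w x * g x) univ = 0 := by
  set P := σ.toJordanDecomposition.posPart
  set N := σ.toJordanDecomposition.negPart
  set Q := τ.toJordanDecomposition.posPart
  set M := τ.toJordanDecomposition.negPart
  set μ := P + N + (Q + M)
  have aP : P ≪ μ := (Measure.le_add_right (Measure.le_add_right le_rfl)).absolutelyContinuous
  have aN : N ≪ μ := (Measure.le_add_right (Measure.le_add_left le_rfl)).absolutelyContinuous
  have aQ : Q ≪ μ := (Measure.le_add_left (Measure.le_add_right le_rfl)).absolutelyContinuous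
  have aM : M ≪ μ := (Measure.le_add_left (Measure.le_add_left le_rfl)).absolutelyContinuous
  have : IsFiniteMeasure μ := inferInstanceAs (IsFiniteMeasure (P + N + (Q + M)))
  have int : ∀ (R : Measure ℝ) [IsFiniteMeasure R] (k : ℝ → ℝ), R ≪ μ → BddMeas k →
      Integrable (fun x => (R.rnDeriv μ x).toReal * k x) μ := by
    intro R hR0 k hR hk
    have : R.HaveLebesgueDecomposition μ := Measure.haveLebesgueDecomposition_of_sigmaFinite R μ
    exact (integrable_toReal_rnDeriv_mul_iff hR).2 (hk.integrable R)
  let D : ℝ → ℝ := fun x => ((P.rnDeriv μ x).toReal * f x - (N.rnDeriv μ x).toReal * f x) +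
    ((Q.rnDeriv μ x).toReal * g x - (M.rnDeriv μ x).toReal * g x)
  have hD : D =ᵐ[μ] 0 := by
    refine Integrable.ae_eq_zero_of_forall_setIntegral_eq_zero
      (((int P f aP hf).sub (int N f aN hf)).add ((int Q g aQ hg).sub (int M g aM hg))) ?_
    intro s hs _
    rw [← h s hs, sInt, sInt, integral_add, integral_sub, integral_sub,
      setIntegral_toReal_rnDeriv_mul aP hs, setIntegral_toReal_rnDeriv_mul aN hs,
      setIntegral_toReal_rnDeriv_mul aQ hs, setIntegral_toReal_rnDeriv_mul aM hs]
    exacts [(int Q g aQ hg).integrableOn, (int M g aM hg).integrableOn,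
      (int P f aP hf).integrableOn, (int N f aN hf).integrableOn,
      ((int P f aP hf).sub (int N f aN hf)).integrableOn,
      ((int Q g aQ hg).sub (int M g aM hg)).integrableOn]
  have hwf := hw.mul hf
  have hwg := hw.mul hg
  rw [sInt_univ, sInt_univ, ← integral_toReal_rnDeriv_mul aP, ← integral_toReal_rnDeriv_mul aN,
    ← integral_toReal_rnDeriv_mul aQ, ← integral_toReal_rnDeriv_mul aM,
    ← integral_sub (int P _ aP hwf) (int N _ aN hwf),
    ← integral_sub (int Q _ aQ hwg) (int M _ aM hwg),
    ← integral_add (f := fun x => (P.rnDeriv μ x).toReal * (w x * f x) -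
        (N.rnDeriv μ x).toReal * (w x * f x)) (g := fun x => (Q.rnDeriv μ x).toReal * (w x * g x) -
        (M.rnDeriv μ x).toReal * (w x * g x)) ((int P _ aP hwf).sub (int N _ aN hwf))
      ((int Q _ aQ hwg).sub (int M _ aM hwg))]
  refine integral_eq_zero_of_ae ?_
  filter_upwards [hD] with x hx
  have : w x * D x = 0 := by rw [hx]; simp
  simp only [D] at this
  simp only [Pi.zero_apply]
  linarith

end signed

section fubini

variable {w : ℝ → ℝ} {S : Set (ℝ × ℝ)}

lemma BddMeas.setIntegral_fiber (hw : BddMeas w) (hS : MeasurableSet S) (μ : Measure ℝ)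
    [IsFiniteMeasure μ] : BddMeas fun x => ∫ t in {t | (x, t) ∈ S}, w t ∂μ := by
  have hS' : ∀ x : ℝ, MeasurableSet {t : ℝ | (x, t) ∈ S} := fun x => measurable_prodMk_left hS
  have e : (fun x => ∫ t in {t | (x, t) ∈ S}, w t ∂μ) =
      fun x => ∫ t, S.indicator (fun p => w p.2) (x, t) ∂μ := by
    funext x
    rw [← integral_indicator (hS' x)]
    rfl
  obtain ⟨hm, C, hC⟩ := hw
  refine ⟨?_, C * μ.real univ, fun x => ?_⟩
  · rw [e]
    exact (((hm.comp measurable_snd).indicator hS).stronglyMeasurable.integral_prod_right').measurable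
  · have h1 := norm_setIntegral_le_of_norm_le_const (s := {t | (x, t) ∈ S}) (μ := μ) (f := w)
      (measure_lt_top _ _) (fun t _ => hC t)
    refine h1.trans (mul_le_mul_of_nonneg_left (measureReal_mono (subset_univ _)) ?_)
    exact (abs_nonneg _).trans (hC 0)

lemma integral_setIntegral_fiber (hw : BddMeas w) (hS : MeasurableSet S) (μ P : Measure ℝ)
    [IsFiniteMeasure μ] [IsFiniteMeasure P] :
    ∫ x, ∫ t in {t | (x, t) ∈ S}, w t ∂μ ∂P = ∫ t, w t * P.real {x | (x, t) ∈ S} ∂μ := by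
  have hS' : ∀ x : ℝ, MeasurableSet {t : ℝ | (x, t) ∈ S} := fun x => measurable_prodMk_left hS
  have hS'' : ∀ t : ℝ, MeasurableSet {x : ℝ | (x, t) ∈ S} := fun t => measurable_prodMk_right hS
  have e : ∀ x, ∫ t in {t | (x, t) ∈ S}, w t ∂μ =
      ∫ t, S.indicator (fun p => w p.2) (x, t) ∂μ := by
    intro x
    rw [← integral_indicator (hS' x)]
    rfl
  have e' : ∀ t, w t * P.real {x | (x, t) ∈ S} = ∫ x, S.indicator (fun p => w p.2) (x, t) ∂P := by
    intro t
    have : (fun x => S.indicator (fun p => w p.2) (x, t)) =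
      {x | (x, t) ∈ S}.indicator fun _ => w t := rfl
    rw [this, integral_indicator (hS'' t), setIntegral_const, smul_eq_mul, mul_comm]
  simp_rw [e, e']
  refine integral_integral_swap (f := fun x t => S.indicator (fun p => w p.2) (x, t)) ?_
  obtain ⟨hm, C, hC⟩ := hw
  refine Integrable.of_bound ((hm.comp measurable_snd).indicator hS).aestronglyMeasurable C
    (Filter.Eventually.of_forall fun p => ?_)
  exact (norm_indicator_le_norm_self (fun p : ℝ × ℝ => w p.2) p).trans (hC p.2)

lemma sInt_setIntegral_fiber (hw : BddMeas w) (hS : MeasurableSet S) (σ : SignedMeasure ℝ)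
    (μ : Measure ℝ) [IsFiniteMeasure μ] :
    sInt σ (fun x => ∫ t in {t | (x, t) ∈ S}, w t ∂μ) univ =
      ∫ t, w t * σ {x | (x, t) ∈ S} ∂μ := by
  have hS'' : ∀ t : ℝ, MeasurableSet {x : ℝ | (x, t) ∈ S} := fun t => measurable_prodMk_right hS
  have meas : ∀ P : Measure ℝ, IsFiniteMeasure P → BddMeas fun t => P.real {x | (x, t) ∈ S} := by
    intro P _
    have h := (BddMeas.const 1).setIntegral_fiber (S := Prod.swap ⁻¹' S) (measurable_swap hS) P
    simpa using h
  rw [sInt_univ, integral_setIntegral_fiber hw hS, integral_setIntegral_fiber hw hS,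
    ← integral_sub ((hw.mul (meas _ inferInstance)).integrable _)
      ((hw.mul (meas _ inferInstance)).integrable _)]
  congr 1
  funext t
  rw [σ.apply_eq_posPart_real_sub_negPart_real (hS'' t)]
  ring

lemma bddMeas_signed_fiber (hS : MeasurableSet S) (σ : SignedMeasure ℝ) :
    BddMeas fun t => σ {x | (x, t) ∈ S} := by
  have hS'' : ∀ t : ℝ, MeasurableSet {x : ℝ | (x, t) ∈ S} := fun t => measurable_prodMk_right hS
  have meas : ∀ P : Measure ℝ, IsFiniteMeasure P → BddMeas fun t => P.real {x | (x, t) ∈ S} := by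
    intro P _
    have h := (BddMeas.const 1).setIntegral_fiber (S := Prod.swap ⁻¹' S) (measurable_swap hS) P
    simpa using h
  simp_rw [fun t => σ.apply_eq_posPart_real_sub_negPart_real (hS'' t)]
  exact (meas _ inferInstance).sub (meas _ inferInstance)

/-- Fubini's theorem for the measures of the fibers of `S` under two signed measures. -/
lemma sInt_fiber_swap (hS : MeasurableSet S) (σ τ : SignedMeasure ℝ) :
    sInt σ (fun x => τ {t | (x, t) ∈ S}) univ = sInt τ (fun t => σ {x | (x, t) ∈ S}) univ := by
  have hS' : ∀ x : ℝ, MeasurableSet {t : ℝ | (x, t) ∈ S} := fun x => measurable_prodMk_left hS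
  have h1 := BddMeas.const 1
  have e : (fun x => τ {t | (x, t) ∈ S}) = fun x =>
      (∫ t in {t | (x, t) ∈ S}, (1 : ℝ) ∂τ.toJordanDecomposition.posPart) -
        ∫ t in {t | (x, t) ∈ S}, (1 : ℝ) ∂τ.toJordanDecomposition.negPart := by
    funext x
    rw [τ.apply_eq_posPart_real_sub_negPart_real (hS' x)]
    simp
  rw [e, sInt_sub σ (h1.setIntegral_fiber hS _) (h1.setIntegral_fiber hS _),
    sInt_setIntegral_fiber h1 hS, sInt_setIntegral_fiber h1 hS, sInt_univ τ]
  simp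

end fubini

section IsLS

variable {a b : ℝ} {f g : ℝ → ℝ} {ν : SignedMeasure ℝ}

lemma rLim_right (b : ℝ) (f : ℝ → ℝ) : rLim b f b = f b := if_neg (lt_irrefl b)

lemma rLim_eq_of_continuousWithinAt {x : ℝ} (hx : x ∈ Icc a b)
    (hf : ∀ x ∈ Ico a b, ContinuousWithinAt f (Ioi x) x) : rLim b f x = f x := by
  rcases hx.2.lt_or_eq with h | rfl
  · rw [rLim, if_pos h]
    exact rightLim_eq_of_tendsto (hf x ⟨hx.1, h⟩)
  · exact rLim_right _ _

lemma rLim_eq_rightLim_extend (hab : a ≤ b) {x : ℝ} (hx : x ∈ Icc a b) :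
    rLim b f x = Function.rightLim (extend hab f) x := by
  rcases hx.2.lt_or_eq with h | rfl
  · rw [rLim, if_pos h]
    have he : ∀ᶠ y in nhdsWithin x (Ioi x), extend hab f y = f y := by
      filter_upwards [Ioo_mem_nhdsGT h] with y hy
      exact extend_of_mem hab ⟨hx.1.trans hy.1.le, hy.2.le⟩
    by_cases hl : ∃ y, Filter.Tendsto f (nhdsWithin x (Ioi x)) (nhds y)
    · obtain ⟨y, hy⟩ := hl
      rw [rightLim_eq_of_tendsto hy, rightLim_eq_of_tendsto (hy.congr' (he.mono fun _ h => h.symm))]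
    · rw [rightLim_eq_of_not_tendsto f hl,
        rightLim_eq_of_not_tendsto, extend_of_mem hab hx]
      rintro ⟨y, hy⟩
      exact hl ⟨y, hy.congr' he⟩
  · rw [rLim_right]
    refine (rightLim_eq_of_tendsto (tendsto_const_nhds.congr' ?_)).symm
    filter_upwards [self_mem_nhdsWithin] with y hy
    rw [extend_apply, projIcc_of_right_le hab (le_of_lt hy)]

lemma leftLim_extend_left (hab : a ≤ b) : Function.leftLim (extend hab f) a = f a := by
  refine leftLim_eq_of_tendsto (tendsto_const_nhds.congr' ?_)
  filter_upwards [self_mem_nhdsWithin] with y hy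
  rw [extend_apply, projIcc_of_le_left hab (le_of_lt hy)]

lemma tendsto_rLim_left (hab : a ≤ b) (hf : BoundedVariationOn f (Icc a b)) {x : ℝ}
    (hx : x ∈ Ioc a b) (hc : ContinuousWithinAt f (Iio x) x) :
    Filter.Tendsto (rLim b f) (nhdsWithin x (Iio x)) (nhds (f x)) := by
  have hbv := boundedVariationOn_extend hab hf
  have h1 := hbv.rightLim.tendsto_leftLim x
  rw [leftLim_rightLim (hbv.tendsto_leftLim x)] at h1
  have he : ∀ᶠ y in nhdsWithin x (Iio x), y ∈ Icc a b := by
    filter_upwards [Ioo_mem_nhdsLT hx.1] with y hy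
    exact ⟨hy.1.le, hy.2.le.trans hx.2⟩
  have h2 : Function.leftLim (extend hab f) x = f x :=
    leftLim_eq_of_tendsto (hc.tendsto.congr' (he.mono fun y hy => (extend_of_mem hab hy).symm))
  rw [h2] at h1
  exact h1.congr' (he.mono fun y hy => (rLim_eq_rightLim_extend hab hy).symm)

lemma exists_isLS (hab : a ≤ b) (hf : BoundedVariationOn f (Icc a b)) : ∃ ν, IsLS a b f ν := by
  have hbv := boundedVariationOn_extend hab hf
  refine ⟨hbv.vectorMeasure.restrict (Icc a b), ?_, ?_, ?_⟩
  · intro s hs h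
    rw [VectorMeasure.restrict_apply _ measurableSet_Icc hs, h, VectorMeasure.empty]
  · intro x y hax hxy hyb
    rw [VectorMeasure.restrict_apply _ measurableSet_Icc measurableSet_Ioc,
      inter_eq_left.2 (Ioc_subset_Icc_self.trans (Icc_subset_Icc hax hyb)),
      hbv.vectorMeasure_Ioc hxy, rLim_eq_rightLim_extend hab ⟨hax, hxy.trans hyb⟩,
      rLim_eq_rightLim_extend hab ⟨hax.trans hxy, hyb⟩]
  · rw [VectorMeasure.restrict_apply _ measurableSet_Icc (measurableSet_singleton a),
      inter_eq_left.2 (singleton_subset_iff.2 (left_mem_Icc.2 hab)),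
      hbv.vectorMeasure_singleton, leftLim_extend_left,
      rLim_eq_rightLim_extend hab (left_mem_Icc.2 hab)]

namespace IsLS

lemma sInt_congr (h : IsLS a b f ν) {k l : ℝ → ℝ} (hkl : EqOn k l (Icc a b)) (s : Set ℝ) :
    sInt ν k s = sInt ν l s :=
  sInt_congr_of_null measurableSet_Icc
    (fun t ht hts => h.1 t ht (disjoint_left.2 fun _ hx hx' => hts hx hx').inter_eq) hkl s

lemma sInt_Icc (h : IsLS a b f ν) (k : ℝ → ℝ) : sInt ν k (Icc a b) = sInt ν k univ := by
  obtain ⟨h1, h2⟩ := jordan_null (measurableSet_Icc.compl) fun t ht hts =>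
    h.1 t ht (disjoint_left.2 fun _ hx hx' => hts hx hx').inter_eq
  rw [sInt, sInt, setIntegral_congr_set (ae_eq_univ.2 h1), setIntegral_congr_set (ae_eq_univ.2 h2)]

lemma apply_Iic (h : IsLS a b f ν) {x : ℝ} (hx : x ∈ Icc a b) : ν (Iic x) = rLim b f x - f a := by
  have e : Iic x = Iio a ∪ ({a} ∪ Ioc a x) := by
    ext y; simp only [mem_Iic, mem_union, mem_Iio, mem_singleton_iff, mem_Ioc]
    have := hx.1; grind
  rw [e, VectorMeasure.of_union _ measurableSet_Iio ((measurableSet_singleton a).union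
      measurableSet_Ioc), VectorMeasure.of_union _ (measurableSet_singleton a) measurableSet_Ioc,
    h.2.2, h.2.1 a x le_rfl hx.1 hx.2, h.1 _ measurableSet_Iio]
  · ring
  · ext y; simp only [mem_inter_iff, mem_Iio, mem_Icc]; grind
  · simp
  · rw [disjoint_left]; intro y; simp only [mem_union, mem_Iio, mem_singleton_iff, mem_Ioc]; grind

lemma apply_univ (hab : a ≤ b) (h : IsLS a b f ν) : ν univ = f b - f a := by
  have e : (univ : Set ℝ) = Iic b ∪ Ioi b := Iic_union_Ioi.symm
  rw [e, VectorMeasure.of_union (Iic_disjoint_Ioi le_rfl) measurableSet_Iic measurableSet_Ioi,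
    h.apply_Iic (right_mem_Icc.2 hab), rLim_right, h.1 _ measurableSet_Ioi, add_zero]
  ext y; simp only [mem_inter_iff, mem_Ioi, mem_Icc]; grind

lemma apply_Ioi (h : IsLS a b f ν) {x : ℝ} (hx : x ∈ Icc a b) : ν (Ioi x) = f b - rLim b f x := by
  have h1 := h.apply_univ (hx.1.trans hx.2)
  have h2 := h.apply_Iic hx
  rw [← Iic_union_Ioi (a := x), VectorMeasure.of_union (Iic_disjoint_Ioi le_rfl)
    measurableSet_Iic measurableSet_Ioi] at h1
  linarith

lemma apply_Iio (h : IsLS a b f ν) (hf : BoundedVariationOn f (Icc a b)) {x : ℝ} (hx : x ∈ Icc a b)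
    (hc : ∀ x ∈ Ioc a b, ContinuousWithinAt f (Iio x) x) : ν (Iio x) = f x - f a := by
  rcases hx.1.eq_or_lt with rfl | hax
  · rw [h.1 _ measurableSet_Iio, sub_self]
    ext y; simp only [mem_inter_iff, mem_Iio, mem_Icc]; grind
  obtain ⟨u, u_mono, u_mem, u_lim⟩ := exists_seq_strictMono_tendsto' hax
  have hU : Iio x = ⋃ n, Iic (u n) := by
    ext y
    simp only [mem_Iio, mem_iUnion, mem_Iic]
    refine ⟨fun hy => ?_, fun ⟨n, hn⟩ => hn.trans_lt (u_mem n).2⟩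
    obtain ⟨n, hn⟩ := (u_lim.eventually (lt_mem_nhds hy)).exists
    exact ⟨n, hn.le⟩
  have h1 : Filter.Tendsto (fun n => ν (Iic (u n))) Filter.atTop (nhds (ν (Iio x))) := by
    rw [hU]
    exact VectorMeasure.tendsto_vectorMeasure_iUnion_atTop_nat
      (fun m n hmn => Iic_subset_Iic.2 (u_mono.monotone hmn)) fun _ => measurableSet_Iic
  have hu : Filter.Tendsto u Filter.atTop (nhdsWithin x (Iio x)) :=
    tendsto_nhdsWithin_of_tendsto_nhds_of_eventually_within _ u_lim
      (Filter.Eventually.of_forall fun n => (u_mem n).2)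
  have h2 := ((tendsto_rLim_left (hx.1.trans hx.2) hf ⟨hax, hx.2⟩
    (hc x ⟨hax, hx.2⟩)).comp hu).sub_const (f a)
  refine tendsto_nhds_unique h1 (h2.congr fun n => ?_)
  exact (h.apply_Iic ⟨(u_mem n).1.le, (u_mem n).2.le.trans hx.2⟩).symm

end IsLS

lemma continuousWithinAt_Iio_of_continuousOn (hf : ContinuousOn f (Icc a b)) :
    ∀ x ∈ Ioc a b, ContinuousWithinAt f (Iio x) x := fun x hx =>
  (hf x ⟨hx.1.le, hx.2⟩).mono_of_mem_nhdsWithin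
    (Filter.mem_of_superset (Ioo_mem_nhdsLT hx.1) fun _ hy => ⟨hy.1.le, hy.2.le.trans hx.2⟩)

lemma continuousWithinAt_Ioi_of_continuousOn (hf : ContinuousOn f (Icc a b)) :
    ∀ x ∈ Ico a b, ContinuousWithinAt f (Ioi x) x := fun x hx =>
  (hf x ⟨hx.1, hx.2.le⟩).mono_of_mem_nhdsWithin
    (Filter.mem_of_superset (Ioo_mem_nhdsGT hx.2) fun _ hy => ⟨hx.1.trans hy.1.le, hy.2.le⟩)

/-- Integration by parts for a left-continuous integrator and a continuous integrand. -/
lemma sInt_by_parts_left (hab : a ≤ b) {νg : SignedMeasure ℝ} (hν : IsLS a b f ν)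
    (hνg : IsLS a b g νg) (hf : ContinuousOn f (Icc a b))
    (hgBV : BoundedVariationOn g (Icc a b))
    (hg : ∀ x ∈ Ioc a b, ContinuousWithinAt g (Iio x) x) :
    g b * f b - sInt νg f (Icc a b) = g a * f a + sInt ν (extend hab g) univ := by
  have hS : MeasurableSet {p : ℝ × ℝ | p.1 < p.2} := measurableSet_lt measurable_fst measurable_snd
  have e1 : sInt νg f univ = sInt νg (fun x => f b - ν {t | (x, t) ∈ {p : ℝ × ℝ | p.1 < p.2}})
      univ := by
    refine hνg.sInt_congr (fun x hx => ?_) _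
    have := hν.apply_Ioi hx
    rw [rLim_eq_of_continuousWithinAt hx (continuousWithinAt_Ioi_of_continuousOn hf)] at this
    change f x = f b - ν (Ioi x)
    rw [this]; ring
  have m1 : BddMeas fun x => ν {t | (x, t) ∈ {p : ℝ × ℝ | p.1 < p.2}} :=
    bddMeas_signed_fiber (S := Prod.swap ⁻¹' {p : ℝ × ℝ | p.1 < p.2}) (measurable_swap hS) ν
  have e2 : sInt ν (fun t => νg {x | (x, t) ∈ {p : ℝ × ℝ | p.1 < p.2}}) univ =
      sInt ν (fun t => extend hab g t - g a) univ := by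
    refine hν.sInt_congr (fun t ht => ?_) _
    change νg (Iio t) = _
    rw [hνg.apply_Iio hgBV ht hg, extend_of_mem hab ht]
  rw [hνg.sInt_Icc, e1, sInt_sub νg (BddMeas.const _) m1, sInt_fiber_swap hS, e2,
    sInt_sub ν (bddMeas_extend hab hgBV) (BddMeas.const _), sInt_const, sInt_const,
    hν.apply_univ hab, hνg.apply_univ hab]
  ring

/-- Integration by parts for a right-continuous integrator and a continuous integrand. -/
lemma sInt_by_parts_right (hab : a ≤ b) {νg : SignedMeasure ℝ} (hν : IsLS a b f ν)
    (hνg : IsLS a b g νg) (hf : ContinuousOn f (Icc a b)) (hfBV : BoundedVariationOn f (Icc a b))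
    (hgBV : BoundedVariationOn g (Icc a b))
    (hg : ∀ x ∈ Ico a b, ContinuousWithinAt g (Ioi x) x) :
    g a * f a + sInt νg f (Icc a b) = g b * f b - sInt ν (extend hab g) univ := by
  have hS : MeasurableSet {p : ℝ × ℝ | p.2 < p.1} := measurableSet_lt measurable_snd measurable_fst
  have hS' : MeasurableSet {p : ℝ × ℝ | p.1 < p.2} := measurableSet_lt measurable_fst measurable_snd
  have e1 : sInt νg f univ = sInt νg (fun x => ν {t | (x, t) ∈ {p : ℝ × ℝ | p.2 < p.1}} - (-f a))
      univ := by
    refine hνg.sInt_congr (fun x hx => ?_) _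
    have := hν.apply_Iio hfBV hx (continuousWithinAt_Iio_of_continuousOn hf)
    change f x = ν (Iio x) - (-f a)
    rw [this]; ring
  have m1 : BddMeas fun x => ν {t | (x, t) ∈ {p : ℝ × ℝ | p.2 < p.1}} :=
    bddMeas_signed_fiber hS' ν
  have e2 : sInt ν (fun t => νg {x | (x, t) ∈ {p : ℝ × ℝ | p.2 < p.1}}) univ =
      sInt ν (fun t => g b - extend hab g t) univ := by
    refine hν.sInt_congr (fun t ht => ?_) _
    change νg (Ioi t) = _
    rw [hνg.apply_Ioi ht, extend_of_mem hab ht, rLim_eq_of_continuousWithinAt ht hg]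
  rw [hνg.sInt_Icc, e1, sInt_sub νg m1 (BddMeas.const _), sInt_fiber_swap hS, e2,
    sInt_sub ν (BddMeas.const _) (bddMeas_extend hab hgBV), sInt_const, sInt_const,
    hν.apply_univ hab, hνg.apply_univ hab]
  ring

end IsLS

section arrivals

variable {a b : ℝ} {lm lp : ℝ → ℝ} {μ : Measure ℝ}

lemma measure_inter_Icc_eq (h : μ (Icc a b)ᶜ = 0) (s : Set ℝ) : μ (s ∩ Icc a b) = μ s :=
  measure_congr ((ae_eq_refl s).inter (ae_eq_univ.2 h)) |>.trans (by rw [inter_univ])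

namespace IsMuMinus

lemma isFiniteMeasure (hab : a ≤ b) (h : IsMuMinus a b lm μ) : IsFiniteMeasure μ := by
  refine ⟨?_⟩
  rw [← measure_inter_Icc_eq h.2, univ_inter, h.1 a (left_mem_Icc.2 hab)]
  exact ENNReal.ofReal_lt_top

lemma real_Ici (h : IsMuMinus a b lm μ) (h0 : ∀ x ∈ Icc a b, 0 ≤ lm x) {x : ℝ}
    (hx : x ∈ Icc a b) : μ.real (Ici x) = lm x := by
  have e : Ici x ∩ Icc a b = Icc x b := by
    ext y; simp only [mem_inter_iff, mem_Ici, mem_Icc]; have := hx.1; grind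
  rw [measureReal_def, ← measure_inter_Icc_eq h.2, e, h.1 x hx, ENNReal.toReal_ofReal (h0 x hx)]

lemma real_singleton (hab : a ≤ b) (h : IsMuMinus a b lm μ) (h0 : ∀ x ∈ Icc a b, 0 ≤ lm x)
    (hc : ContinuousOn lm (Icc a b)) {x : ℝ} (hx : x ∈ Ico a b) : μ.real {x} = 0 := by
  have := h.isFiniteMeasure hab
  refine le_antisymm ?_ measureReal_nonneg
  have hl := (continuousWithinAt_Ioi_of_continuousOn hc x hx).tendsto.const_sub (lm x)
  rw [sub_self] at hl
  refine ge_of_tendsto hl ?_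
  filter_upwards [Ioo_mem_nhdsGT hx.2] with s hs
  have hs' : s ∈ Icc a b := ⟨hx.1.trans hs.1.le, hs.2.le⟩
  rw [← h.real_Ici h0 hs', ← h.real_Ici h0 ⟨hx.1, hx.2.le⟩,
    ← measureReal_sdiff (Ici_subset_Ici.2 hs.1.le) measurableSet_Ici]
  exact measureReal_mono (singleton_subset_iff.2 ⟨mem_Ici.2 le_rfl, fun h => not_le.2 hs.1 h⟩)

lemma isLS (hab : a ≤ b) (h : IsMuMinus a b lm μ) (h0 : ∀ x ∈ Icc a b, 0 ≤ lm x)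
    (hc : ContinuousOn lm (Icc a b)) [IsFiniteMeasure μ] :
    IsLS a b lm (-(μ.restrict (Iio b)).toSignedMeasure) := by
  have happ : ∀ s : Set ℝ, MeasurableSet s →
      (-(μ.restrict (Iio b)).toSignedMeasure) s = -μ.real (s ∩ Iio b) := by
    intro s hs
    rw [neg_apply, Measure.toSignedMeasure_apply_measurable hs,
      measureReal_restrict_apply hs]
  have hr : ∀ x ∈ Icc a b, rLim b lm x = lm x := fun x hx =>
    rLim_eq_of_continuousWithinAt hx (continuousWithinAt_Ioi_of_continuousOn hc)
  have hat : ∀ x ∈ Icc a b, μ.real ({x} ∩ Iio b) = 0 := by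
    intro x hx
    rcases hx.2.lt_or_eq with hxb | rfl
    · rw [inter_eq_left.2 (singleton_subset_iff.2 (mem_Iio.2 hxb))]
      exact h.real_singleton hab h0 hc ⟨hx.1, hxb⟩
    · simp
  have hIco : ∀ x ∈ Icc a b, μ.real (Ioi x ∩ Iio b) = lm x - lm b := by
    intro x hx
    have e : Ici x \ Ici b = ({x} ∩ Iio b) ∪ (Ioi x ∩ Iio b) := by
      ext y; simp only [mem_sdiff, mem_Ici, mem_union, mem_inter_iff, mem_singleton_iff, mem_Iio,
        mem_Ioi]; have := hx.2; grind
    have e1 := measureReal_sdiff (μ := μ) (Ici_subset_Ici.2 hx.2) measurableSet_Ici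
    rw [e, measureReal_union _ (measurableSet_Ioi.inter measurableSet_Iio), hat x hx,
      h.real_Ici h0 hx, h.real_Ici h0 (right_mem_Icc.2 hab), zero_add] at e1
    · exact e1
    · rw [disjoint_left]; rintro y ⟨rfl, -⟩ ⟨h2, -⟩; exact lt_irrefl y h2
  refine ⟨fun s hs hsI => ?_, fun x y hx hxy hy => ?_, ?_⟩
  · rw [happ s hs, measureReal_def,
      measure_mono_null (inter_subset_left.trans
        (disjoint_iff_inter_eq_empty.2 hsI).subset_compl_right) h.2]
    simp
  · have hx' : x ∈ Icc a b := ⟨hx, hxy.trans hy⟩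
    have hy' : y ∈ Icc a b := ⟨hx.trans hxy, hy⟩
    have e : Ioc x y ∩ Iio b = (Ioi x ∩ Iio b) \ (Ioi y ∩ Iio b) := by
      ext z; simp only [mem_sdiff, mem_inter_iff, mem_Ioc, mem_Iio, mem_Ioi]; grind
    rw [happ _ measurableSet_Ioc, e, measureReal_sdiff
      (inter_subset_inter_left _ (Ioi_subset_Ioi hxy)) (measurableSet_Ioi.inter measurableSet_Iio),
      hIco x hx', hIco y hy', hr x hx', hr y hy']
    ring
  · have ha := left_mem_Icc.2 hab
    rw [happ _ (measurableSet_singleton a), hat a ha, hr a ha]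
    simp

end IsMuMinus

namespace IsMuPlus

lemma isFiniteMeasure (hab : a ≤ b) (h : IsMuPlus a b lp μ) : IsFiniteMeasure μ := by
  refine ⟨?_⟩
  rw [← measure_inter_Icc_eq h.2, univ_inter, h.1 b (right_mem_Icc.2 hab)]
  exact ENNReal.ofReal_lt_top

lemma real_Iic (h : IsMuPlus a b lp μ) (h0 : ∀ x ∈ Icc a b, 0 ≤ lp x) {x : ℝ}
    (hx : x ∈ Icc a b) : μ.real (Iic x) = lp x := by
  have e : Iic x ∩ Icc a b = Icc a x := by
    ext y; simp only [mem_inter_iff, mem_Iic, mem_Icc]; have := hx.2; grind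
  rw [measureReal_def, ← measure_inter_Icc_eq h.2, e, h.1 x hx, ENNReal.toReal_ofReal (h0 x hx)]

lemma isLS (hab : a ≤ b) (h : IsMuPlus a b lp μ) (h0 : ∀ x ∈ Icc a b, 0 ≤ lp x)
    (hc : ContinuousOn lp (Icc a b)) [IsFiniteMeasure μ] :
    IsLS a b lp (μ.restrict (Ioi a)).toSignedMeasure := by
  have happ : ∀ s : Set ℝ, MeasurableSet s →
      (μ.restrict (Ioi a)).toSignedMeasure s = μ.real (s ∩ Ioi a) := by
    intro s hs
    rw [Measure.toSignedMeasure_apply_measurable hs, measureReal_restrict_apply hs]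
  have hr : ∀ x ∈ Icc a b, rLim b lp x = lp x := fun x hx =>
    rLim_eq_of_continuousWithinAt hx (continuousWithinAt_Ioi_of_continuousOn hc)
  refine ⟨fun s hs hsI => ?_, fun x y hx hxy hy => ?_, ?_⟩
  · rw [happ s hs, measureReal_def,
      measure_mono_null (inter_subset_left.trans
        (disjoint_iff_inter_eq_empty.2 hsI).subset_compl_right) h.2]
    simp
  · have hx' : x ∈ Icc a b := ⟨hx, hxy.trans hy⟩
    have hy' : y ∈ Icc a b := ⟨hx.trans hxy, hy⟩
    have e : Ioc x y ∩ Ioi a = Iic y \ Iic x := by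
      ext z; simp only [mem_sdiff, mem_inter_iff, mem_Ioc, mem_Iic, mem_Ioi]; grind
    rw [happ _ measurableSet_Ioc, e, measureReal_sdiff (Iic_subset_Iic.2 hxy) measurableSet_Iic,
      h.real_Iic h0 hx', h.real_Iic h0 hy', hr x hx', hr y hy']
  · have ha := left_mem_Icc.2 hab
    rw [happ _ (measurableSet_singleton a), hr a ha]
    simp

end IsMuPlus

end arrivals

section generator

variable {a b x y : ℝ} {lm lp wm wp : ℝ → ℝ} {μm μp : Measure ℝ}

open scoped Classical in
/-- The order book with best buy offer `x` and best sell offer `y`, holding at most one order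
on each side. -/
def pairBook (a b x y : ℝ) : OrderBook := ⟨if x = a then 0 else {x}, if y = b then 0 else {y}⟩

lemma isConfig_pairBook (hx : a ≤ x) (hxy : x < y) (hy : y ≤ b) :
    IsConfig a b (pairBook a b x y) := by
  refine ⟨fun z hz => ?_, fun z hz => ?_, fun z hz t ht => ?_⟩
  · by_cases h : x = a <;> simp [pairBook, h] at hz
    subst hz; exact ⟨lt_of_le_of_ne hx (Ne.symm h), hxy.trans_le hy⟩
  · by_cases h : y = b <;> simp [pairBook, h] at hz
    subst hz; exact ⟨hx.trans_lt hxy, lt_of_le_of_ne hy h⟩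
  · by_cases h : x = a <;> simp [pairBook, h] at hz
    by_cases h' : y = b <;> simp [pairBook, h'] at ht
    subst hz ht; exact hxy

lemma Mminus_pairBook (hx : a ≤ x) : Mminus a (pairBook a b x y) = x := by
  by_cases h : x = a
  · simp [Mminus, pairBook, h]
  · simp [Mminus, pairBook, h, hx]

lemma Mplus_pairBook (hy : y ≤ b) : Mplus b (pairBook a b x y) = y := by
  by_cases h : y = b
  · simp [Mplus, pairBook, h]
  · simp [Mplus, pairBook, h, hy]

lemma linF_Lminus_sub (hxy : x < y) (hy : y ≤ b) (hwm : wm a = 0)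
    (hwp : wp b = 0) {u : ℝ} (hu : u ∈ Icc a b) :
    linF wm wp (Lminus a b u (pairBook a b x y)) - linF wm wp (pairBook a b x y) =
      (Iio y).indicator wm u - (Ici y).indicator (fun _ => wp y) u := by
  rw [Lminus, Mplus_pairBook hy]
  by_cases h : y = b
  · subst h
    rcases hu.2.lt_or_eq with hub | rfl
    · rcases hu.1.eq_or_lt with rfl | hau
      · simp [pairBook, linF, hub, hwm]
      · simp [pairBook, linF, hub, hau]
    · simp [pairBook, linF, hwp]
  · have hyb := lt_of_le_of_ne hy h
    rcases le_or_gt y u with hyu | hyu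
    · simp [pairBook, linF, hyu, h]
    · rcases hu.1.eq_or_lt with rfl | hau
      · simp [pairBook, linF, hyu, hyu.not_ge, hwm]
      · simp [pairBook, linF, hyu, hyu.not_ge, hau, hyu.trans hyb]

lemma linF_Lplus_sub (hx : a ≤ x) (hwm : wm a = 0)
    (hwp : wp b = 0) {u : ℝ} (hu : u ∈ Icc a b) :
    linF wm wp (Lplus a b u (pairBook a b x y)) - linF wm wp (pairBook a b x y) =
      (Ioi x).indicator wp u - (Iic x).indicator (fun _ => wm x) u := by
  rw [Lplus, Mminus_pairBook hx]
  by_cases h : x = a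
  · subst h
    rcases hu.1.eq_or_lt with rfl | hau
    · simp [pairBook, linF, hwm]
    · rcases hu.2.lt_or_eq with hub | rfl
      · simp [pairBook, linF, hub, hau]
      · simp [pairBook, linF, hau, hwp]
  · have hax := lt_of_le_of_ne hx (Ne.symm h)
    rcases le_or_gt u x with hux | hux
    · simp [pairBook, linF, hux, h]
    · rcases hu.2.lt_or_eq with hub | rfl
      · simp [pairBook, linF, hux, hux.not_ge, hax.trans hux, hub]
      · simp [pairBook, linF, hux, hux.not_ge, hwp]

lemma genOp_pairBook (hab : a ≤ b) (hx : a ≤ x) (hxy : x < y) (hy : y ≤ b)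
    (hμm : IsMuMinus a b lm μm) (hμp : IsMuPlus a b lp μp)
    (hlm : ∀ x ∈ Icc a b, 0 ≤ lm x) (hlp : ∀ x ∈ Icc a b, 0 ≤ lp x)
    (hwmBV : BoundedVariationOn wm (Icc a b)) (hwpBV : BoundedVariationOn wp (Icc a b))
    (hwm : wm a = 0) (hwp : wp b = 0) :
    genOp a b μm μp (linF wm wp) (pairBook a b x y) =
      ((∫ u in Iio y, extend hab wm u ∂μm) - wp y * lm y) +
        ((∫ u in Ioi x, extend hab wp u ∂μp) - wm x * lp x) := by
  have := hμm.isFiniteMeasure hab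
  have := hμp.isFiniteMeasure hab
  rw [genOp]
  congr 1
  · rw [← hμm.real_Ici hlm ⟨hx.trans hxy.le, hy⟩, mul_comm, ← smul_eq_mul, ← setIntegral_const,
      ← integral_indicator measurableSet_Iio, ← integral_indicator measurableSet_Ici,
      ← integral_sub ((((bddMeas_extend hab hwmBV).integrable μm)).indicator measurableSet_Iio)
        ((integrable_const _).indicator measurableSet_Ici)]
    refine integral_congr_ae ?_
    filter_upwards [mem_ae_iff.2 hμm.2] with u hu
    rw [linF_Lminus_sub hxy hy hwm hwp hu, indicator_apply, indicator_apply (Iio y),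
      extend_of_mem hab hu]
  · rw [← hμp.real_Iic hlp ⟨hx, hxy.le.trans hy⟩, mul_comm, ← smul_eq_mul, ← setIntegral_const,
      ← integral_indicator measurableSet_Ioi, ← integral_indicator measurableSet_Iic,
      ← integral_sub ((((bddMeas_extend hab hwpBV).integrable μp)).indicator measurableSet_Ioi)
        ((integrable_const _).indicator measurableSet_Iic)]
    refine integral_congr_ae ?_
    filter_upwards [mem_ae_iff.2 hμp.2] with u hu
    rw [linF_Lplus_sub hx hwm hwp hu, indicator_apply, indicator_apply (Ioi x),
      extend_of_mem hab hu]

end generator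

section weights

variable {a b : ℝ} {f g U W : ℝ → ℝ} {ν : SignedMeasure ℝ} {ρ : Measure ℝ} {k : ℝ}

lemma apply_sdiff_singleton {x : ℝ} (h : ν {x} = 0) {t : Set ℝ} (ht : MeasurableSet t) :
    ν (t \ {x}) = ν t := by
  by_cases hx : x ∈ t
  · rw [← VectorMeasure.of_add_of_sdiff (measurableSet_singleton x) ht (singleton_subset_iff.2 hx), h,
      zero_add]
  · rw [sdiff_singleton_eq_self hx]

lemma IsLS.sInt_congr_Ioo (hab : a ≤ b) (h : IsLS a b f ν) (hf : ContinuousOn f (Icc a b))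
    (hfBV : BoundedVariationOn f (Icc a b)) {k l : ℝ → ℝ} (hkl : EqOn k l (Ioo a b)) (s : Set ℝ) :
    sInt ν k s = sInt ν l s := by
  have hb := right_mem_Icc.2 hab
  have na : ν {a} = 0 := by
    rw [h.2.2, rLim_eq_of_continuousWithinAt (left_mem_Icc.2 hab)
      (continuousWithinAt_Ioi_of_continuousOn hf), sub_self]
  have nb : ν {b} = 0 := by
    have h1 := h.apply_Iic hb
    rw [← Iio_union_right, VectorMeasure.of_union (by simp) measurableSet_Iio
      (measurableSet_singleton b), rLim_right,
      h.apply_Iio hfBV hb (continuousWithinAt_Iio_of_continuousOn hf)] at h1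
    linarith
  refine sInt_congr_of_null measurableSet_Ioo (fun t ht hts => ?_) hkl s
  rw [← h.1 ((t \ {a}) \ {b}) ((ht.diff (measurableSet_singleton a)).diff
      (measurableSet_singleton b)), apply_sdiff_singleton nb (ht.diff (measurableSet_singleton a)),
    apply_sdiff_singleton na ht]
  ext x
  simp only [mem_inter_iff, mem_sdiff, mem_singleton_iff, mem_Icc, mem_empty_iff_false, iff_false]
  rintro ⟨⟨⟨hx, hxa⟩, hxb⟩, h1, h2⟩
  exact hts hx ⟨lt_of_le_of_ne h1 (Ne.symm hxa), lt_of_le_of_ne h2 hxb⟩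

/-- The contribution to the constant of a weight function on the sell side. -/
lemma mul_add_sInt_eq_left (hab : a < b) (hν : IsLS a b f ν) (hf : ContinuousOn f (Icc a b))
    (hfBV : BoundedVariationOn f (Icc a b)) [IsFiniteMeasure ρ] (hρ : ρ (Ioc a b)ᶜ = 0)
    (hW : BddMeas W) (hU : BddMeas U) (hUa : U a = 0)
    (hg : ∀ x ∈ Ico a b, g x = (∫ t in Ioi x, W t ∂ρ) - U x + k) :
    g a * f a + sInt ν (extend hab.le g) univ =
      (∫ t, W t * extend hab.le f t ∂ρ) - sInt ν U univ + k * f b := by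
  have hS : MeasurableSet {p : ℝ × ℝ | p.1 < p.2} := measurableSet_lt measurable_fst measurable_snd
  have hF := bddMeas_extend hab.le hfBV
  have e1 : sInt ν (extend hab.le g) univ =
      sInt ν (fun x => (∫ t in {t | (x, t) ∈ {p : ℝ × ℝ | p.1 < p.2}}, W t ∂ρ) - (U x - k))
        univ := by
    refine hν.sInt_congr_Ioo hab.le hf hfBV (fun x hx => ?_) _
    rw [extend_of_mem hab.le (Ioo_subset_Icc_self hx), hg x (Ioo_subset_Ico_self hx), sub_add]
    rfl
  have e2 : ∫ t, W t * ν {x | (x, t) ∈ {p : ℝ × ℝ | p.1 < p.2}} ∂ρ =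
      ∫ t, (W t * extend hab.le f t - W t * f a) ∂ρ := by
    refine integral_congr_ae ?_
    filter_upwards [mem_ae_iff.2 hρ] with t ht
    have ht' := Ioc_subset_Icc_self ht
    change W t * ν (Iio t) = _
    rw [hν.apply_Iio hfBV ht' (continuousWithinAt_Iio_of_continuousOn hf), extend_of_mem hab.le ht']
    ring
  have e3 : ∫ t in Ioi a, W t ∂ρ = ∫ t, W t ∂ρ := by
    rw [Measure.restrict_eq_self_of_ae_mem]
    filter_upwards [mem_ae_iff.2 hρ] with t ht using ht.1
  rw [e1, sInt_sub ν (hW.setIntegral_fiber hS ρ) (hU.sub (BddMeas.const k)),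
    sInt_setIntegral_fiber hW hS, e2, integral_sub ((hW.mul hF).integrable ρ)
      ((hW.mul (BddMeas.const _)).integrable ρ), integral_mul_const,
    sInt_sub ν hU (BddMeas.const k), sInt_const, hν.apply_univ hab.le, hg a (left_mem_Ico.2 hab), e3,
    hUa]
  ring

/-- The contribution to the constant of a weight function on the buy side. -/
lemma mul_sub_sInt_eq_right (hab : a < b) (hν : IsLS a b f ν) (hf : ContinuousOn f (Icc a b))
    (hfBV : BoundedVariationOn f (Icc a b)) [IsFiniteMeasure ρ] (hρ : ρ (Ico a b)ᶜ = 0)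
    (hW : BddMeas W) (hU : BddMeas U) (hUb : U b = 0)
    (hg : ∀ x ∈ Ioc a b, g x = (∫ t in Iio x, W t ∂ρ) - U x + k) :
    g b * f b - sInt ν (extend hab.le g) univ =
      (∫ t, W t * extend hab.le f t ∂ρ) + sInt ν U univ + k * f a := by
  have hS : MeasurableSet {p : ℝ × ℝ | p.2 < p.1} := measurableSet_lt measurable_snd measurable_fst
  have hF := bddMeas_extend hab.le hfBV
  have e1 : sInt ν (extend hab.le g) univ =
      sInt ν (fun x => (∫ t in {t | (x, t) ∈ {p : ℝ × ℝ | p.2 < p.1}}, W t ∂ρ) - (U x - k))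
        univ := by
    refine hν.sInt_congr_Ioo hab.le hf hfBV (fun x hx => ?_) _
    rw [extend_of_mem hab.le (Ioo_subset_Icc_self hx), hg x (Ioo_subset_Ioc_self hx), sub_add]
    rfl
  have e2 : ∫ t, W t * ν {x | (x, t) ∈ {p : ℝ × ℝ | p.2 < p.1}} ∂ρ =
      ∫ t, (W t * f b - W t * extend hab.le f t) ∂ρ := by
    refine integral_congr_ae ?_
    filter_upwards [mem_ae_iff.2 hρ] with t ht
    have ht' := Ico_subset_Icc_self ht
    change W t * ν (Ioi t) = _
    rw [hν.apply_Ioi ht', rLim_eq_of_continuousWithinAt ht'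
      (continuousWithinAt_Ioi_of_continuousOn hf), extend_of_mem hab.le ht']
    ring
  have e3 : ∫ t in Iio b, W t ∂ρ = ∫ t, W t ∂ρ := by
    rw [Measure.restrict_eq_self_of_ae_mem]
    filter_upwards [mem_ae_iff.2 hρ] with t ht using ht.2
  rw [e1, sInt_sub ν (hW.setIntegral_fiber hS ρ) (hU.sub (BddMeas.const k)),
    sInt_setIntegral_fiber hW hS, e2, integral_sub ((hW.mul (BddMeas.const _)).integrable ρ)
      ((hW.mul hF).integrable ρ), integral_mul_const,
    sInt_sub ν hU (BddMeas.const k), sInt_const, hν.apply_univ hab.le, hg b (right_mem_Ioc.2 hab), e3,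
    hUb]
  ring

end weights

/-- under (A3) and (A6), with `(fm, fp)` the unique solution of Luckock's
equation, if `c` is the constant for which there exist admissible weight functions
`(wm, wp)` whose linear functional `F` satisfies
`GF(X) = gm(M₋(X)) + gp(M₊(X)) − c` for all configurations `X`, then
`c = gm(b)·fm(b) − ∫_{Ī} fm dgm + gp(a)·fp(a) + ∫_{Ī} fp dgp`.
Here `νgm, νgp` are the Lebesgue-Stieltjes measures of `gm, gp` on `[a,b]`. -/
theorem stmt9 (a b : ℝ) (hab : a < b) (lm lp : ℝ → ℝ)
    (hA3 : A3 a b lm lp) (hA6 : A6 a b lm lp)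
    (fm fp : ℝ → ℝ) (hsol : LuckockSol a b lm lp fm fp)
    (μm μp : MeasureTheory.Measure ℝ)
    (hμm : IsMuMinus a b lm μm) (hμp : IsMuPlus a b lp μp)
    (gm gp : ℝ → ℝ)
    (hgmB : ∃ C, ∀ x ∈ Set.Icc a b, |gm x| ≤ C)
    (hgpB : ∃ C, ∀ x ∈ Set.Icc a b, |gp x| ≤ C)
    (hgmBV : BoundedVariationOn gm (Set.Icc a b))
    (hgpBV : BoundedVariationOn gp (Set.Icc a b))
    (hgmL : ∀ x ∈ Set.Ioc a b, ContinuousWithinAt gm (Set.Iio x) x)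
    (hgpR : ∀ x ∈ Set.Ico a b, ContinuousWithinAt gp (Set.Ioi x) x)
    (νgm νgp : MeasureTheory.SignedMeasure ℝ)
    (hνgm : IsLS a b gm νgm) (hνgp : IsLS a b gp νgp)
    (c : ℝ)
    (hc : ∃ wm wp : ℝ → ℝ, WPair a b wm wp ∧
      ∀ X : OrderBook, IsConfig a b X →
        genOp a b μm μp (linF wm wp) X = gm (Mminus a X) + gp (Mplus b X) - c) :
    c = gm b * fm b - sInt νgm fm (Set.Icc a b) +
        gp a * fp a + sInt νgp fp (Set.Icc a b) := by
  obtain ⟨hlmC, hlpC, -, -, hlm0, hlp0⟩ := hA3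
  obtain ⟨hfmC, hfpC, hfmBV, hfpBV, hfmb, hfpa, hL⟩ := hsol
  obtain ⟨wm, wp, ⟨-, -, hwmBV, hwpBV, -, -, hwma, hwpb⟩, hG⟩ := hc
  have hab' := hab.le
  have := hμm.isFiniteMeasure hab'
  have := hμp.isFiniteMeasure hab'
  set ρm := μm.restrict (Iio b) with hρm
  set ρp := μp.restrict (Ioi a) with hρp
  have hρm0 : ρm (Ico a b)ᶜ = 0 := by
    rw [hρm, Measure.restrict_apply measurableSet_Ico.compl]
    exact measure_mono_null (fun t ht (h : t ∈ Icc a b) => ht.1 ⟨h.1, ht.2⟩) hμm.2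
  have hρp0 : ρp (Ioc a b)ᶜ = 0 := by
    rw [hρp, Measure.restrict_apply measurableSet_Ioc.compl]
    exact measure_mono_null (fun t ht (h : t ∈ Icc a b) => ht.1 ⟨ht.2, h.2⟩) hμp.2
  have hνlm : IsLS a b lm (-ρm.toSignedMeasure) := hμm.isLS hab' hlm0 hlmC
  have hνlp : IsLS a b lp ρp.toSignedMeasure := hμp.isLS hab' hlp0 hlpC
  obtain ⟨νfm, hνfm⟩ := exists_isLS hab' hfmBV
  obtain ⟨νfp, hνfp⟩ := exists_isLS hab' hfpBV
  have hWm := bddMeas_extend hab' hwmBV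
  have hWp := bddMeas_extend hab' hwpBV
  have hFm := bddMeas_extend hab' hfmBV
  have hFp := bddMeas_extend hab' hfpBV
  have hLm := bddMeas_extend_of_continuousOn hab' hlmC
  have hLp := bddMeas_extend_of_continuousOn hab' hlpC
  have hG' : ∀ x y, a ≤ x → x < y → y ≤ b →
      ((∫ u in Iio y, extend hab' wm u ∂ρm) - wp y * lm y) +
        ((∫ u in Ioi x, extend hab' wp u ∂ρp) - wm x * lp x) = gm x + gp y - c := by
    intro x y hx hxy hy
    have h := hG _ (isConfig_pairBook hx hxy hy)
    rw [genOp_pairBook hab' hx hxy hy hμm hμp hlm0 hlp0 hwmBV hwpBV hwma hwpb,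
      Mminus_pairBook hx, Mplus_pairBook hy] at h
    rwa [hρm, hρp, Measure.restrict_restrict measurableSet_Iio,
      Measure.restrict_restrict measurableSet_Ioi, inter_eq_left.2 (Iio_subset_Iio hy),
      inter_eq_left.2 (Ioi_subset_Ioi hx)]
  set km := gm a - ∫ u in Ioi a, extend hab' wp u ∂ρp with hkm
  set kp := gp b - ∫ u in Iio b, extend hab' wm u ∂ρm with hkp
  have h0 := hG' a b le_rfl hab le_rfl
  rw [hwma, hwpb, zero_mul, zero_mul, sub_zero, sub_zero] at h0
  have hgm : ∀ x ∈ Ico a b, gm x = (∫ u in Ioi x, extend hab' wp u ∂ρp) -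
      extend hab' wm x * extend hab' lp x + km := by
    intro x hx
    have h := hG' x b hx.1 hx.2 le_rfl
    rw [hwpb, zero_mul, sub_zero] at h
    rw [extend_of_mem hab' (Ico_subset_Icc_self hx), extend_of_mem hab' (Ico_subset_Icc_self hx)]
    linarith
  have hgp : ∀ y ∈ Ioc a b, gp y = (∫ u in Iio y, extend hab' wm u ∂ρm) -
      extend hab' wp y * extend hab' lm y + kp := by
    intro y hy
    have h := hG' a y le_rfl hy.1 hy.2
    rw [hwma, zero_mul, sub_zero] at h
    rw [extend_of_mem hab' (Ioc_subset_Icc_self hy), extend_of_mem hab' (Ioc_subset_Icc_self hy)]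
    linarith
  have hLp' := sInt_mul_add_eq_zero hFm hLm hWp fun s hs => by
    rw [hνlp.sInt_congr (fun x hx => extend_of_mem hab' hx) s,
      hνfp.sInt_congr (fun x hx => extend_of_mem hab' hx) s]
    exact (hL _ _ _ _ hνlm hνlp hνfm hνfp s hs).1
  have hLm' := sInt_mul_add_eq_zero hFp hLp hWm fun s hs => by
    rw [hνlm.sInt_congr (fun x hx => extend_of_mem hab' hx) s,
      hνfm.sInt_congr (fun x hx => extend_of_mem hab' hx) s]
    exact (hL _ _ _ _ hνlm hνlp hνfm hνfp s hs).2
  rw [sInt_toSignedMeasure, Measure.restrict_univ] at hLp'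
  rw [sInt_neg, sInt_toSignedMeasure, Measure.restrict_univ] at hLm'
  have hm := mul_add_sInt_eq_left hab hνfm hfmC hfmBV hρp0 hWp (hWm.mul hLp)
    (by rw [extend_of_mem hab' (left_mem_Icc.2 hab'), hwma, zero_mul]) hgm
  have hp := mul_sub_sInt_eq_right hab hνfp hfpC hfpBV hρm0 hWm (hWp.mul hLm)
    (by rw [extend_of_mem hab' (right_mem_Icc.2 hab'), hwpb, zero_mul]) hgp
  rw [hfmb, mul_one] at hm
  rw [hfpa, mul_one] at hp
  rw [add_assoc, sInt_by_parts_left hab' hνfm hνgm hfmC hgmBV hgmL,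
    sInt_by_parts_right hab' hνfp hνgp hfpC hfpBV hgpBV hgpR, hm, hp]
  linarith
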